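/- Let μ be a probability measure on a Polish space and f a bounded measurable real-valued function with ∫ f² dμ = 1. Let b denote the essential supremum and a the essential infimum of |f| with respect to μ (so 0 ≤ a ≤ 1 ≤ b). Then Ent_μ(f²) ≤ 2(b − a)². -/

import Mathlib

open MeasureTheory Finset Real Filter

noncomputable section

/-- Operator norm of a `k`-tensor indexed by tuples in `[n]^k`. -/
def tOp {n k : ℕ} (A : (Fin k → Fin n) → ℝ) : ℝ :=
  ⨆ v : {v : Fin k → Fin n → ℝ // ∀ j, ∑ i, (v j i) ^ 2 ≤ 1},
    ∑ idx : Fin k → Fin n, (∏ j, v.1 j (idx j)) * A idx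

/-- `k`-th order difference `𝔥_{i_1 … i_k} f` (L^∞ taken as sup over the involved coordinates). -/
def hOrd {n : ℕ} {𝒳 : Fin n → Type*} (f : (∀ i, 𝒳 i) → ℝ) (k : ℕ)
    (idx : Fin k → Fin n) (x : ∀ i, 𝒳 i) : ℝ :=
  ⨆ y : (∀ i, 𝒳 i) × (∀ i, 𝒳 i),
    |∑ S ∈ (Finset.univ : Finset (Fin k)).powerset, (-1 : ℝ) ^ S.card *
      f (fun i => if i ∈ Finset.image idx S then y.2 i
                  else if i ∈ Finset.image idx Finset.univ then y.1 i else x i)|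

/-- The `k`-tensor `𝔥^{(k)} f`. -/
def hT {n : ℕ} {𝒳 : Fin n → Type*} (f : (∀ i, 𝒳 i) → ℝ) (k : ℕ)
    (idx : Fin k → Fin n) (x : ∀ i, 𝒳 i) : ℝ :=
  if Function.Injective idx then hOrd f k idx x else 0

/-- First order difference `𝔥_i f` (sup over both replaced coordinates). -/
def hI {n : ℕ} {𝒳 : Fin n → Type*} (f : (∀ i, 𝒳 i) → ℝ) (i : Fin n) (x : ∀ j, 𝒳 j) : ℝ :=
  ⨆ y : 𝒳 i × 𝒳 i, |f (Function.update x i y.1) - f (Function.update x i y.2)|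

/-- `𝔥⁺_i f`. -/
def hPlusI {n : ℕ} {𝒳 : Fin n → Type*} (f : (∀ i, 𝒳 i) → ℝ) (i : Fin n) (x : ∀ j, 𝒳 j) : ℝ :=
  ⨆ y : 𝒳 i, max (f x - f (Function.update x i y)) 0

/-- `𝔥⁻_i f`. -/
def hMinusI {n : ℕ} {𝒳 : Fin n → Type*} (f : (∀ i, 𝒳 i) → ℝ) (i : Fin n) (x : ∀ j, 𝒳 j) : ℝ :=
  ⨆ y : 𝒳 i, max (f (Function.update x i y) - f x) 0

/-- `L^p(μ)` norm. -/
def lpN {α : Type*} [MeasurableSpace α] (μ : Measure α) (p : ℝ) (g : α → ℝ) : ℝ :=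
  (∫ x, |g x| ^ p ∂μ) ^ (1 / p)

/-- Entropy functional `Ent_μ(g)`. -/
def ent {α : Type*} [MeasurableSpace α] (μ : Measure α) (g : α → ℝ) : ℝ :=
  ∫ x, g x * Real.log (g x) ∂μ - (∫ x, g x ∂μ) * Real.log (∫ x, g x ∂μ)

/-- Variance with respect to a measure. -/
def cVar {β : Type*} [MeasurableSpace β] (ν : Measure β) (g : β → ℝ) : ℝ :=
  ∫ y, (g y - ∫ y', g y' ∂ν) ^ 2 ∂ν

/-- `ν i x` is the conditional distribution of the `i`-th coordinate given the others. -/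
def IsCondKernel {n : ℕ} {𝒳 : Fin n → Type*} [∀ i, MeasurableSpace (𝒳 i)]
    (μ : Measure (∀ i, 𝒳 i)) (ν : ∀ i, (∀ j, 𝒳 j) → Measure (𝒳 i)) : Prop :=
  (∀ i x, IsProbabilityMeasure (ν i x)) ∧
  (∀ i x x', (∀ j, j ≠ i → x j = x' j) → ν i x = ν i x') ∧
  (∀ i (g : (∀ j, 𝒳 j) → ℝ), Measurable g → (∃ M, ∀ x, |g x| ≤ M) →
    ∫ x, ∫ y, g (Function.update x i y) ∂(ν i x) ∂μ = ∫ x, g x ∂μ)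

/-- `|𝔡 f|²`. -/
def dSq {n : ℕ} {𝒳 : Fin n → Type*} [∀ i, MeasurableSpace (𝒳 i)]
    (ν : ∀ i, (∀ j, 𝒳 j) → Measure (𝒳 i)) (f : (∀ i, 𝒳 i) → ℝ) (x : ∀ i, 𝒳 i) : ℝ :=
  ∑ i, cVar (ν i x) (fun y => f (Function.update x i y))

/-- The `𝔡`-logarithmic Sobolev inequality with constant `σ2`. -/
def DLSI {n : ℕ} {𝒳 : Fin n → Type*} [∀ i, MeasurableSpace (𝒳 i)]
    (μ : Measure (∀ i, 𝒳 i)) (ν : ∀ i, (∀ j, 𝒳 j) → Measure (𝒳 i)) (σ2 : ℝ) : Prop :=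
  IsCondKernel μ ν ∧
  ∀ f : (∀ i, 𝒳 i) → ℝ, Measurable f → (∃ M, ∀ x, |f x| ≤ M) →
    ent μ (fun x => f x ^ 2) ≤ 2 * σ2 * ∫ x, dSq ν f x ∂μ

end

theorem mul_log_le_sq_sub_self {h : ℝ} (hh : 0 ≤ h) : h * Real.log h ≤ h ^ 2 - h := by
  rcases hh.eq_or_lt with rfl | hp
  · simp
  · nlinarith [mul_le_mul_of_nonneg_left (Real.log_le_sub_one_of_pos hp) hh]

theorem sub_one_le_mul_log {h : ℝ} (hh : 0 ≤ h) : h - 1 ≤ h * Real.log h := by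
  rcases hh.eq_or_lt with rfl | hp
  · simp
  · have := mul_le_mul_of_nonneg_left (Real.one_sub_inv_le_log_of_pos hp) hh
    rwa [mul_sub, mul_inv_cancel₀ hp.ne', mul_one] at this

/-- the one-dimensional entropy estimate `Ent_μ(f²) ≤ 2(b-a)²` for a
normalized bounded function (key step in the proof of
Theorem `theorem:hLSIapproximatetensorization`). -/
theorem stmt19 {α : Type*} [TopologicalSpace α] [PolishSpace α] [MeasurableSpace α]
    [BorelSpace α] (μ : Measure α) (hμ : IsProbabilityMeasure μ)
    (f : α → ℝ) (hf : Measurable f) (hbd : ∃ M, ∀ x, |f x| ≤ M)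
    (hnorm : ∫ x, f x ^ 2 ∂μ = 1)
    (a b : ℝ) (ha : 0 ≤ a) (hab : ∀ᵐ x ∂μ, a ≤ |f x| ∧ |f x| ≤ b) :
    ent μ (fun x => f x ^ 2) ≤ 2 * (b - a) ^ 2 := by
  obtain ⟨M, hM⟩ := hbd
  have hint : Integrable (fun x => f x ^ 2) μ := by
    refine Integrable.of_bound (hf.pow_const 2).aestronglyMeasurable (M ^ 2) (ae_of_all _ ?_)
    intro x
    rw [Real.norm_eq_abs, abs_pow]
    exact pow_le_pow_left₀ (abs_nonneg _) (hM x) 2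
  have hb : 0 ≤ b := by
    obtain ⟨x, hx⟩ := hab.exists
    linarith
  have hsq : ∀ᵐ x ∂μ, a ^ 2 ≤ f x ^ 2 ∧ f x ^ 2 ≤ b ^ 2 := by
    filter_upwards [hab] with x hx
    rw [← sq_abs (f x)]
    exact ⟨pow_le_pow_left₀ ha hx.1 2, pow_le_pow_left₀ (abs_nonneg _) hx.2 2⟩
  have ha1 : a ≤ 1 := by
    have h := integral_mono_ae (integrable_const (a ^ 2)) hint (hsq.mono fun x hx => hx.1)
    rw [hnorm, integral_const, probReal_univ, one_smul] at h
    nlinarith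
  have hb1 : 1 ≤ b := by
    have h := integral_mono_ae hint (integrable_const (b ^ 2)) (hsq.mono fun x hx => hx.2)
    rw [hnorm, integral_const, probReal_univ, one_smul] at h
    nlinarith
  have hchord : Integrable (fun x => (a ^ 2 + b ^ 2 - 1) * f x ^ 2 - a ^ 2 * b ^ 2) μ :=
    (hint.const_mul _).sub (integrable_const _)
  have hupper : ∀ᵐ x ∂μ, f x ^ 2 * Real.log (f x ^ 2) ≤
      (a ^ 2 + b ^ 2 - 1) * f x ^ 2 - a ^ 2 * b ^ 2 := by
    filter_upwards [hsq] with x hx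
    nlinarith [mul_log_le_sq_sub_self (sq_nonneg (f x)),
      mul_nonneg (sub_nonneg.2 hx.1) (sub_nonneg.2 hx.2)]
  have hlog : Integrable (fun x => f x ^ 2 * Real.log (f x ^ 2)) μ :=
    integrable_of_le_of_le (by fun_prop)
      (ae_of_all _ fun x => sub_one_le_mul_log (sq_nonneg (f x))) hupper
      (hint.sub (integrable_const 1)) hchord
  have hle := integral_mono_ae hlog hchord hupper
  rw [integral_sub (hint.const_mul _) (integrable_const _), integral_const_mul, hnorm,
    integral_const, probReal_univ, one_smul] at hle
  unfold ent
  rw [hnorm, Real.log_one]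
  have hs : 0 ≤ 1 - a := sub_nonneg.2 ha1
  have hr : 0 ≤ b - 1 := sub_nonneg.2 hb1
  have key : 2 * (b - a) ^ 2 - (a ^ 2 + b ^ 2 - 1 - a ^ 2 * b ^ 2) =
      2 * (b - 1) ^ 2 * a + 2 * (1 - a) ^ 2 + 2 * (1 - a) ^ 2 * (b - 1)
        + (1 - a) ^ 2 * (b - 1) ^ 2 := by ring
  have : 0 ≤ 2 * (b - 1) ^ 2 * a + 2 * (1 - a) ^ 2 + 2 * (1 - a) ^ 2 * (b - 1)
        + (1 - a) ^ 2 * (b - 1) ^ 2 := by positivity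
  linarith
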